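/- Let (n,m) ∈ ℕ² with (n,m) ≠ (1,1), let a₁, …, aₙ, b₁, …, bₘ ∈ ℝ with aₙ ≠ 0 and bₘ ≠ 0, and set v(x,z) = Σ_{i=1}^{n} aᵢ xⁱ + Σ_{j=1}^{m} bⱼ zʲ. Consider the loop L_v on ℝ³ with multiplication (x₁,y₁,z₁) ∗ (x₂,y₂,z₂) = (x₁+x₂, y₁+y₂ − x₂·v(x₁,z₁), z₁+z₂). Then the subgroup of the permutation group of ℝ³ generated by all left translations λ_a : x ↦ a ∗ x and all right translations ρ_a : x ↦ x ∗ a, a ∈ ℝ³, is a nilpotent group. -/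

import Mathlib

open Finset

/-- The loop multiplication on `ℝ³` of the loop `L_v` with
`v(x,z) = Σ_{i=1}^{n} aᵢ xⁱ + Σ_{j=1}^{m} bⱼ zʲ`:
`(x₁,y₁,z₁) ∗ (x₂,y₂,z₂) = (x₁+x₂, y₁+y₂ − x₂·v(x₁,z₁), z₁+z₂)`. -/
noncomputable def loopMul (n m : ℕ) (a b : ℕ → ℝ) (p q : ℝ × ℝ × ℝ) : ℝ × ℝ × ℝ :=
  (p.1 + q.1,
    p.2.1 + q.2.1 -
      q.1 * (∑ i ∈ Icc 1 n, a i * p.1 ^ i + ∑ j ∈ Icc 1 m, b j * p.2.2 ^ j),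
    p.2.2 + q.2.2)

open scoped fwdDiff commutatorElement

/-- The functions `f : V → ℝ` annihilated by any `k` successive forward differences, that is, the
generalised polynomials of degree less than `k`. -/
def diffPolyLT (V : Type*) [AddCommGroup V] : ℕ → Submodule ℝ (V → ℝ)
  | 0 => ⊥
  | k + 1 =>
    { carrier := {f | ∀ h, Δ_[h] f ∈ diffPolyLT V k}
      add_mem' := fun hf hg h => by
        rw [fwdDiff_add]
        exact add_mem (hf h) (hg h)
      zero_mem' := fun h => by
        have : Δ_[h] (0 : V → ℝ) = 0 := fwdDiff_const h 0
        rw [this]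
        exact zero_mem _
      smul_mem' := fun c f hf h => by
        rw [fwdDiff_const_smul]
        exact Submodule.smul_mem _ c (hf h) }

namespace diffPolyLT

variable {V : Type*} [AddCommGroup V] {k : ℕ} {f : V → ℝ}

lemma mem_zero : f ∈ diffPolyLT V 0 ↔ f = 0 := Submodule.mem_bot ℝ

lemma mem_succ : f ∈ diffPolyLT V (k + 1) ↔ ∀ h, Δ_[h] f ∈ diffPolyLT V k := Iff.rfl

lemma monotone : Monotone (diffPolyLT V) := by
  refine monotone_nat_of_le_succ fun k => ?_
  induction k with
  | zero =>
    intro f hf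
    rw [mem_zero.1 hf]
    exact zero_mem _
  | succ k ih => exact fun f hf h => ih (hf h)

lemma fwdDiff_mem (hf : f ∈ diffPolyLT V k) (h : V) : Δ_[h] f ∈ diffPolyLT V k :=
  monotone k.le_succ hf h

lemma comp_add_right_mem (hf : f ∈ diffPolyLT V k) (h : V) :
    (fun x => f (x + h)) ∈ diffPolyLT V k := by
  have : (fun x => f (x + h)) = f + Δ_[h] f := by
    ext x
    simp [fwdDiff]
  rw [this]
  exact add_mem hf (fwdDiff_mem hf h)

lemma const_mem (c : ℝ) : (fun _ => c : V → ℝ) ∈ diffPolyLT V 1 := fun h => by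
  rw [fwdDiff_const]
  exact zero_mem _

lemma addMonoidHom_mul_mem (φ : V →+ ℝ) (hf : f ∈ diffPolyLT V k) :
    (fun x => φ x * f x) ∈ diffPolyLT V (k + 1) := by
  induction k generalizing f with
  | zero =>
    have : (fun x => φ x * f x) = 0 := by
      ext x
      simp [mem_zero.1 hf]
    rw [this]
    exact zero_mem _
  | succ k ih =>
    intro h
    have : Δ_[h] (fun x => φ x * f x) =
        (fun x => φ x * Δ_[h] f x) + φ h • fun x => f (x + h) := by
      ext x
      simp only [fwdDiff, map_add, Pi.add_apply, Pi.smul_apply, smul_eq_mul]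
      ring
    rw [this]
    exact add_mem (ih (hf h)) (Submodule.smul_mem _ _ (comp_add_right_mem hf h))

lemma addMonoidHom_pow_mem (φ : V →+ ℝ) (k : ℕ) :
    (fun x => φ x ^ k) ∈ diffPolyLT V (k + 1) := by
  induction k with
  | zero => simpa using const_mem 1
  | succ k ih => simpa only [pow_succ'] using addMonoidHom_mul_mem φ ih

lemma sum_addMonoidHom_pow_mem (φ : V →+ ℝ) (n : ℕ) (c : ℕ → ℝ) :
    (fun x => ∑ i ∈ Icc 1 n, c i * φ x ^ i) ∈ diffPolyLT V (n + 1) := by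
  have : (fun x => ∑ i ∈ Icc 1 n, c i * φ x ^ i) = ∑ i ∈ Icc 1 n, c i • fun x => φ x ^ i := by
    ext x
    simp
  rw [this]
  exact sum_mem fun i hi => Submodule.smul_mem _ _
    (monotone (Nat.succ_le_succ (mem_Icc.1 hi).2) (addMonoidHom_pow_mem φ i))

end diffPolyLT

/-- The permutations `(x, y, z) ↦ (x + s, y + f (x, z), z + t)` of `ℝ³` with `(s, t) ∈ S` and
`f` of degree less than `k`. -/
def polyShear (S : AddSubgroup (ℝ × ℝ)) (k : ℕ) : Subgroup (Equiv.Perm (ℝ × ℝ × ℝ)) where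
  carrier := {σ | ∃ s ∈ S, ∃ f ∈ diffPolyLT (ℝ × ℝ) k,
    ∀ x y z, σ (x, y, z) = (x + s.1, y + f (x, z), z + s.2)}
  mul_mem' := by
    rintro σ τ ⟨s, hs, f, hf, hσ⟩ ⟨t, ht, g, hg, hτ⟩
    refine ⟨t + s, add_mem ht hs, _, add_mem hg (diffPolyLT.comp_add_right_mem hf t), ?_⟩
    intro x y z
    simp [hσ, hτ, add_assoc, Prod.add_def]
  one_mem' := ⟨0, zero_mem _, 0, zero_mem _, by simp⟩
  inv_mem' := by
    rintro σ ⟨s, hs, f, hf, hσ⟩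
    refine ⟨-s, neg_mem hs, _, neg_mem (diffPolyLT.comp_add_right_mem hf (-s)), ?_⟩
    intro x y z
    rw [Equiv.Perm.inv_eq_iff_eq, hσ]
    simp [Prod.add_def]

lemma polyShear_bot_zero : polyShear ⊥ 0 = ⊥ := by
  refine (Subgroup.eq_bot_iff_forall _).2 ?_
  rintro σ ⟨s, hs, f, hf, hσ⟩
  rw [AddSubgroup.mem_bot] at hs
  rw [diffPolyLT.mem_zero] at hf
  subst hs hf
  ext ⟨x, y, z⟩ <;> simp [hσ]

lemma commutatorElement_mem_polyShear_bot {k : ℕ} {s t : ℝ × ℝ} {f g : ℝ × ℝ → ℝ}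
    {σ τ : Equiv.Perm (ℝ × ℝ × ℝ)}
    (hσ : ∀ x y z, σ (x, y, z) = (x + s.1, y + f (x, z), z + s.2))
    (hτ : ∀ x y z, τ (x, y, z) = (x + t.1, y + g (x, z), z + t.2))
    (hfg : Δ_[t] f - Δ_[s] g ∈ diffPolyLT (ℝ × ℝ) k) : ⁅σ, τ⁆ ∈ polyShear ⊥ k := by
  refine ⟨0, zero_mem _, _, diffPolyLT.comp_add_right_mem hfg (-(s + t)), fun x y z => ?_⟩
  obtain ⟨⟨x', y', z'⟩, h⟩ := (τ * σ).surjective (x, y, z)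
  have hcomm : ⁅σ, τ⁆ * (τ * σ) = σ * τ := by group
  rw [← h, ← Equiv.Perm.mul_apply, hcomm]
  simp only [Equiv.Perm.mul_apply, hσ, hτ, Prod.mk.injEq] at h ⊢
  obtain ⟨rfl, rfl, rfl⟩ := h
  have : ((x' + s.1 + t.1, z' + s.2 + t.2) : ℝ × ℝ) + -(s + t) = (x', z') := by
    ext <;> simp
  rw [this]
  simp only [Pi.sub_apply, fwdDiff, Prod.fst_zero, Prod.snd_zero]
  refine ⟨by ring, ?_, by ring⟩
  simp only [Prod.add_def]
  ring

lemma lowerCentralSeries_polyShear_le (S : AddSubgroup (ℝ × ℝ)) (N j : ℕ) :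
    (polyShear S N).lowerCentralSeries (j + 1) ≤ polyShear ⊥ (N - j) := by
  induction j with
  | zero =>
    rw [Subgroup.lowerCentralSeries_succ, Subgroup.lowerCentralSeries_zero,
      Subgroup.commutator_le]
    rintro σ ⟨s, -, f, hf, hσ⟩ τ ⟨t, -, g, hg, hτ⟩
    exact commutatorElement_mem_polyShear_bot hσ hτ
      (sub_mem (diffPolyLT.fwdDiff_mem hf t) (diffPolyLT.fwdDiff_mem hg s))
  | succ j ih =>
    rw [Subgroup.lowerCentralSeries_succ, Subgroup.commutator_le]
    rintro σ hσ τ ⟨t, -, g, -, hτ⟩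
    obtain ⟨s, hs, f, hf, hσ⟩ := ih hσ
    rw [AddSubgroup.mem_bot] at hs
    subst hs
    refine commutatorElement_mem_polyShear_bot hσ hτ ?_
    have hg : Δ_[(0 : ℝ × ℝ)] g = 0 := by
      ext x
      simp [fwdDiff]
    rw [hg, sub_zero]
    obtain hk | hk := Nat.eq_zero_or_pos (N - j)
    · rw [hk] at hf
      rw [diffPolyLT.mem_zero.1 hf]
      have : Δ_[t] (0 : ℝ × ℝ → ℝ) = 0 := fwdDiff_const t 0
      rw [this]
      exact zero_mem _
    · obtain ⟨k, hk⟩ := Nat.exists_eq_succ_of_ne_zero hk.ne'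
      rw [hk] at hf
      rw [Nat.sub_succ, hk]
      exact hf t

lemma isNilpotent_of_le_polyShear {H : Subgroup (Equiv.Perm (ℝ × ℝ × ℝ))}
    {S : AddSubgroup (ℝ × ℝ)} {N : ℕ} (h : H ≤ polyShear S N) : Group.IsNilpotent H := by
  refine Subgroup.isNilpotent_of_lowerCentralSeries_eq_bot (n := N + 1) (le_bot_iff.1 ?_)
  calc H.lowerCentralSeries (N + 1) ≤ (polyShear S N).lowerCentralSeries (N + 1) :=
        Subgroup.lowerCentralSeries_mono _ h
    _ ≤ polyShear ⊥ (N - N) := lowerCentralSeries_polyShear_le S N N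
    _ = ⊥ := by rw [Nat.sub_self, polyShear_bot_zero]

/-- For `n, m ≥ 1` with `(n,m) ≠ (1,1)`, `aₙ ≠ 0`, `bₘ ≠ 0` and
`v(x,z) = Σ_{i=1}^{n} aᵢ xⁱ + Σ_{j=1}^{m} bⱼ zʲ`, the multiplication group of the loop
`L_v`, i.e. the subgroup of the permutation group of `ℝ³` generated by all left
translations `λ_a : x ↦ a ∗ x` and all right translations `ρ_a : x ↦ x ∗ a`, is a
nilpotent group. -/
theorem multiplication_group_nilpotent (n m : ℕ) (hn : 1 ≤ n) (hm : 1 ≤ m)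
    (hnm : ¬(n = 1 ∧ m = 1)) (a b : ℕ → ℝ) (han : a n ≠ 0) (hbm : b m ≠ 0) :
    Group.IsNilpotent
      ↥(Subgroup.closure {σ : Equiv.Perm (ℝ × ℝ × ℝ) |
        ∃ p : ℝ × ℝ × ℝ,
          (∀ x, σ x = loopMul n m a b p x) ∨ (∀ x, σ x = loopMul n m a b x p)}) := by
  refine isNilpotent_of_le_polyShear (S := ⊤) (N := n + m + 1) ((Subgroup.closure_le _).2 ?_)
  have hfst : (fun u : ℝ × ℝ => u.1) ∈ diffPolyLT (ℝ × ℝ) (n + m + 1) := by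
    simpa using diffPolyLT.monotone (by omega : 1 + 1 ≤ n + m + 1)
      (diffPolyLT.addMonoidHom_pow_mem (AddMonoidHom.fst ℝ ℝ) 1)
  have hconst (c : ℝ) : (fun _ => c) ∈ diffPolyLT (ℝ × ℝ) (n + m + 1) :=
    diffPolyLT.monotone (by omega) (diffPolyLT.const_mem c)
  have hv : (fun u : ℝ × ℝ => ∑ i ∈ Icc 1 n, a i * u.1 ^ i + ∑ j ∈ Icc 1 m, b j * u.2 ^ j) ∈
      diffPolyLT (ℝ × ℝ) (n + m + 1) :=
    add_mem
      (diffPolyLT.monotone (by omega : n + 1 ≤ n + m + 1)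
        (diffPolyLT.sum_addMonoidHom_pow_mem (AddMonoidHom.fst ℝ ℝ) n a))
      (diffPolyLT.monotone (by omega : m + 1 ≤ n + m + 1)
        (diffPolyLT.sum_addMonoidHom_pow_mem (AddMonoidHom.snd ℝ ℝ) m b))
  rintro σ ⟨p, hσ | hσ⟩
  · refine ⟨(p.1, p.2.2), trivial, _, sub_mem (hconst p.2.1) (Submodule.smul_mem _
      (∑ i ∈ Icc 1 n, a i * p.1 ^ i + ∑ j ∈ Icc 1 m, b j * p.2.2 ^ j) hfst), fun x y z => ?_⟩
    simp only [hσ, loopMul, Pi.sub_apply, Pi.smul_apply, smul_eq_mul, Prod.mk.injEq]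
    refine ⟨?_, ?_, ?_⟩ <;> ring
  · refine ⟨(p.1, p.2.2), trivial, _,
      sub_mem (hconst p.2.1) (Submodule.smul_mem _ p.1 hv), fun x y z => ?_⟩
    simp only [hσ, loopMul, Pi.sub_apply, Pi.smul_apply, smul_eq_mul, Prod.mk.injEq]
    exact ⟨trivial, by ring, trivial⟩
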